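/- (Lower bound on the partition function.) In the Gaussian contextual graph matching model with π* = id, if d = ω((log n)²) and ρ²n/(1−ρ²) + 2η²d/(1−η²) ≤ 2(1−ε) log n for some ε > 0, then Z ≥ exp( ((1+ε)/2) n log n (1+o(1)) ) with probability at least 1 − o(1) as n → ∞. -/

import Mathlib

open MeasureTheory ProbabilityTheory Real Filter Finset Topology

noncomputable section

namespace CGM

/-- array of (potential) edge weights of a graph on `n` vertices -/
abbrev GW (n : ℕ) := Fin n → Fin n → ℝ

/-- array of feature values: `n` users, `d` features each -/
abbrev FW (n d : ℕ) := Fin n → Fin d → ℝ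

/-- latent sample space: (graph weights, graph noise, features, feature noise) -/
abbrev Samp (n d : ℕ) := (GW n × GW n) × (FW n d × FW n d)

/-- i.i.d. standard Gaussian array (graph part) -/
def stdGaussG (n : ℕ) : Measure (GW n) :=
  Measure.pi fun _ => Measure.pi fun _ => gaussianReal 0 1

/-- i.i.d. standard Gaussian array (feature part) -/
def stdGaussF (n d : ℕ) : Measure (FW n d) :=
  Measure.pi fun _ => Measure.pi fun _ => gaussianReal 0 1

/-- law of the latent randomness of the model -/
def μ (n d : ℕ) : Measure (Samp n d) :=
  ((stdGaussG n).prod (stdGaussG n)).prod ((stdGaussF n d).prod (stdGaussF n d))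

/-- symmetrization of an array, so that only the upper-triangular part matters -/
def sym {n : ℕ} (f : GW n) : GW n := fun i j => if i ≤ j then f i j else f j i

variable {n d : ℕ}

/-- the weighted adjacency matrix `A` -/
def Amat (ω : Samp n d) : GW n := sym ω.1.1

/-- the weighted adjacency matrix `B` (before relabeling by `π*`, i.e. conditionally
on `π* = id`): each pair `(A i j, B i j)`, `i < j`, is bivariate centered Gaussian
with unit variances and correlation `ρ`. -/
def Bmat (ρ : ℝ) (ω : Samp n d) : GW n :=
  fun i j => ρ * Amat ω i j + Real.sqrt (1 - ρ ^ 2) * sym ω.1.2 i j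

/-- the feature matrix `X` -/
def Xmat (ω : Samp n d) : FW n d := ω.2.1

/-- the feature matrix `Y` (conditionally on `π* = id`): each pair `(X i j, Y i j)` is
bivariate centered Gaussian with unit variances and correlation `η`. -/
def Ymat (η : ℝ) (ω : Samp n d) : FW n d :=
  fun i j => η * ω.2.1 i j + Real.sqrt (1 - η ^ 2) * ω.2.2 i j

/-- the ordered pairs `i < j` whose unordered pair `{i,j}` is moved by `φ`;
its cardinality is `|D^E_φ|`. -/
def movedEdges (φ : Equiv.Perm (Fin n)) : Finset (Fin n × Fin n) :=
  Finset.univ.filter fun p =>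
    p.1 < p.2 ∧ ¬((φ p.1 = p.1 ∧ φ p.2 = p.2) ∨ (φ p.1 = p.2 ∧ φ p.2 = p.1))

/-- `V*_G(φ) = Σ_{{i,j} ∈ D^E_φ} B_{ij} A_{ij}` -/
def VGstar (ρ : ℝ) (φ : Equiv.Perm (Fin n)) (ω : Samp n d) : ℝ :=
  ∑ p ∈ movedEdges φ, Bmat ρ ω p.1 p.2 * Amat ω p.1 p.2

/-- `V_G(φ) = Σ_{{i,j} ∈ D^E_φ} B_{φ(i,j)} A_{ij}` -/
def VG (ρ : ℝ) (φ : Equiv.Perm (Fin n)) (ω : Samp n d) : ℝ :=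
  ∑ p ∈ movedEdges φ, Bmat ρ ω (φ p.1) (φ p.2) * Amat ω p.1 p.2

/-- `V*_F(φ) = Σ_{i ∈ D_φ, j ≤ d} Y_{ij} X_{ij}` -/
def VFstar (η : ℝ) (φ : Equiv.Perm (Fin n)) (ω : Samp n d) : ℝ :=
  ∑ i ∈ φ.support, ∑ j, Ymat η ω i j * Xmat ω i j

/-- `V_F(φ) = Σ_{i ∈ D_φ, j ≤ d} Y_{φ(i),j} X_{ij}` -/
def VF (η : ℝ) (φ : Equiv.Perm (Fin n)) (ω : Samp n d) : ℝ :=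
  ∑ i ∈ φ.support, ∑ j, Ymat η ω (φ i) j * Xmat ω i j

/-- the Hamiltonian `V(φ)` -/
def V (ρ η : ℝ) (φ : Equiv.Perm (Fin n)) (ω : Samp n d) : ℝ :=
  ρ / (1 - ρ ^ 2) * (VGstar ρ φ ω - VG ρ φ ω)
    + η / (1 - η ^ 2) * (VFstar η φ ω - VF η φ ω)

/-- the partition function `Z = Σ_φ exp(−V(φ))` -/
def Zpart (ρ η : ℝ) (ω : Samp n d) : ℝ :=
  ∑ φ : Equiv.Perm (Fin n), Real.exp (-(V ρ η φ ω))

end CGM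


namespace CGM

open scoped ENNReal

/-- The standard Gaussian measure on the plane. -/
def stdGaussPair : Measure (ℝ × ℝ) := (gaussianReal 0 1).prod (gaussianReal 0 1)

instance : IsProbabilityMeasure stdGaussPair := by
  unfold stdGaussPair; infer_instance

/-- The map turning two independent standard Gaussians into a pair with correlation `r`. -/
def corrMap (r : ℝ) (p : ℝ × ℝ) : ℝ × ℝ := (p.1, r * p.1 + √(1 - r ^ 2) * p.2)

/-- The log-likelihood ratio of the bivariate Gaussian with correlation `r` against the standard
one. -/
def corrLLR (r : ℝ) (p : ℝ × ℝ) : ℝ :=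
  r / (1 - r ^ 2) * (p.1 * p.2) - r ^ 2 / (2 * (1 - r ^ 2)) * (p.1 ^ 2 + p.2 ^ 2)
    - log (1 - r ^ 2) / 2

@[fun_prop]
lemma measurable_corrMap (r : ℝ) : Measurable (corrMap r) := by
  unfold corrMap; fun_prop

@[fun_prop]
lemma measurable_corrLLR (r : ℝ) : Measurable (corrLLR r) := by
  unfold corrLLR; fun_prop

lemma corrLLR_corrMap {r : ℝ} (hr : r ^ 2 < 1) (p : ℝ × ℝ) :
    corrLLR r (corrMap r p) =
      ((r * p.1 + √(1 - r ^ 2) * p.2) ^ 2 - p.2 ^ 2) / 2 - log (1 - r ^ 2) / 2 := by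
  have h : 0 < 1 - r ^ 2 := by linarith
  obtain ⟨s, hs, hs0⟩ : ∃ s, 1 - r ^ 2 = s ^ 2 ∧ 0 < s :=
    ⟨√(1 - r ^ 2), (sq_sqrt h.le).symm, sqrt_pos.2 h⟩
  have h1 : √(1 - r ^ 2) = s := by rw [hs, sqrt_sq hs0.le]
  simp only [corrLLR, corrMap, h1]
  rw [hs]
  have h2 : r ^ 2 = 1 - s ^ 2 := by linarith
  field_simp
  grind

lemma gaussianReal_eq_withDensity_corrLLR {r : ℝ} (hr : r ^ 2 < 1) (a : ℝ) :
    gaussianReal (r * a) (1 - r ^ 2).toNNReal =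
      (gaussianReal 0 1).withDensity fun b => ENNReal.ofReal (exp (corrLLR r (a, b))) := by
  have h : 0 < 1 - r ^ 2 := by linarith
  have hv : (1 - r ^ 2).toNNReal ≠ 0 := (toNNReal_pos.2 h).ne'
  rw [gaussianReal_of_var_ne_zero _ hv, gaussianReal_of_var_ne_zero _ one_ne_zero,
    ← withDensity_mul _ (measurable_gaussianPDF _ _) (by fun_prop)]
  congr 1
  ext b
  simp only [Pi.mul_apply, gaussianPDF, gaussianPDFReal, coe_toNNReal _ h.le, NNReal.coe_one]
  rw [← ENNReal.ofReal_mul (by positivity)]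
  congr 1
  have h3 : (√(1 - r ^ 2))⁻¹ = exp (- log (1 - r ^ 2) / 2) := by
    rw [← exp_log (inv_pos.2 (sqrt_pos.2 h)), log_inv, log_sqrt h.le]; ring_nf
  rw [sqrt_mul (by positivity), mul_inv, h3, mul_assoc, ← exp_add, mul_assoc, ← exp_add,
    corrLLR, mul_one]
  congr 2
  field_simp
  ring

lemma map_corrMap_stdGaussPair {r : ℝ} (hr : r ^ 2 < 1) :
    stdGaussPair.map (corrMap r) =
      stdGaussPair.withDensity fun p => ENNReal.ofReal (exp (corrLLR r p)) := by
  have h : 0 < 1 - r ^ 2 := by linarith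
  ext S hS
  rw [Measure.map_apply (by fun_prop) hS, withDensity_apply _ hS, stdGaussPair,
    Measure.prod_apply (measurable_corrMap r hS), ← lintegral_indicator hS,
    lintegral_prod _ ((by fun_prop : Measurable _).indicator hS).aemeasurable]
  refine lintegral_congr fun a => ?_
  have hSa : MeasurableSet (Prod.mk a ⁻¹' S) := measurable_prodMk_left hS
  have hmap : (gaussianReal 0 1).map (fun z => r * a + √(1 - r ^ 2) * z) =
      gaussianReal (r * a) (1 - r ^ 2).toNNReal := by
    have : (fun z : ℝ => r * a + √(1 - r ^ 2) * z) =
        (fun z => r * a + z) ∘ (fun z => √(1 - r ^ 2) * z) := rfl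
    rw [this, ← Measure.map_map (by fun_prop) (by fun_prop), gaussianReal_map_const_mul,
      gaussianReal_map_const_add]
    congr 1
    · ring
    · ext; simp [sq_sqrt h.le, h.le]
  calc gaussianReal 0 1 (Prod.mk a ⁻¹' (corrMap r ⁻¹' S))
      = (gaussianReal 0 1).map (fun z => r * a + √(1 - r ^ 2) * z) (Prod.mk a ⁻¹' S) := by
        rw [Measure.map_apply (by fun_prop) hSa]; rfl
    _ = _ := by
        rw [hmap, gaussianReal_eq_withDensity_corrLLR hr, withDensity_apply _ hSa,
          ← lintegral_indicator hSa]
        rfl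

lemma pi_withDensity {ι : Type*} [Fintype ι] {X : ι → Type*} [∀ i, MeasurableSpace (X i)]
    (m : ∀ i, Measure (X i)) [∀ i, IsProbabilityMeasure (m i)] {f : ∀ i, X i → ℝ≥0∞}
    (hf : ∀ i, Measurable (f i)) [∀ i, SigmaFinite ((m i).withDensity (f i))] :
    Measure.pi (fun i => (m i).withDensity (f i)) =
      (Measure.pi m).withDensity fun ω => ∏ i, f i (ω i) := by
  refine Measure.pi_eq fun s hs => ?_
  rw [withDensity_apply _ (MeasurableSet.univ_pi hs),
    ← lintegral_indicator (MeasurableSet.univ_pi hs)]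
  have h1 : (Set.univ.pi s).indicator (fun ω => ∏ i, f i (ω i)) =
      fun ω => ∏ i, (s i).indicator (f i) (ω i) := by
    ext ω
    by_cases hω : ω ∈ Set.univ.pi s
    · rw [Set.indicator_of_mem hω]
      exact Finset.prod_congr rfl fun i _ => (Set.indicator_of_mem (hω i trivial) _).symm
    · rw [Set.indicator_of_notMem hω]
      obtain ⟨i, hi⟩ : ∃ i, ω i ∉ s i := by simpa [Set.mem_pi] using hω
      exact (Finset.prod_eq_zero (Finset.mem_univ i) (Set.indicator_of_notMem hi _)).symm
  have hind : ∀ i, Measurable ((s i).indicator (f i)) := fun i => (hf i).indicator (hs i)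
  rw [h1, lintegral_prod_eq_prod_lintegral_of_indepFun Finset.univ
    (fun i (ω : ∀ i, X i) => (s i).indicator (f i) (ω i))
    (iIndepFun_pi fun i => (hind i).aemeasurable)
    (fun i => (hind i).comp (measurable_pi_apply i))]
  refine Finset.prod_congr rfl fun i _ => ?_
  rw [withDensity_apply _ (hs i), ← lintegral_indicator (hs i)]
  exact (measurePreserving_eval m i).lintegral_comp (hind i)

lemma measurePreserving_reindex_snd {ι : Type*} [Fintype ι] (σ : Equiv.Perm ι) :
    MeasurePreserving (fun (ω : ι → ℝ × ℝ) i => ((ω i).1, (ω (σ i)).2))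
      (Measure.pi fun _ => stdGaussPair) (Measure.pi fun _ => stdGaussPair) := by
  have h1 := measurePreserving_arrowProdEquivProdArrow ℝ ℝ ι
    (fun _ => gaussianReal 0 1) (fun _ => gaussianReal 0 1)
  have h2 := measurePreserving_piCongrLeft (fun _ : ι => gaussianReal 0 1) σ.symm
  have h3 := h1.symm.comp (((MeasurePreserving.id _).prod h2).comp h1)
  change MeasurePreserving _ (Measure.pi fun _ => (gaussianReal 0 1).prod (gaussianReal 0 1))
    (Measure.pi fun _ => (gaussianReal 0 1).prod (gaussianReal 0 1))
  convert h3 using 1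
  ext ω i
  · rfl
  · change _ = (MeasurableEquiv.piCongrLeft (fun _ => ℝ) σ.symm) (fun i => (ω i).2) i
    rw [MeasurableEquiv.coe_piCongrLeft]
    have := Equiv.piCongrLeft_apply_apply (fun _ : ι => ℝ) σ.symm (fun i => (ω i).2) (σ i)
    simpa using this.symm

/-- The joint law of independent correlated Gaussian pairs has the product likelihood ratio. -/
lemma map_corrMap_pi {ι : Type*} [Fintype ι] {r : ι → ℝ} (hr : ∀ i, r i ^ 2 < 1) :
    (Measure.pi fun _ : ι => stdGaussPair).map (fun ω i => corrMap (r i) (ω i)) =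
      (Measure.pi fun _ : ι => stdGaussPair).withDensity
        fun ω => ENNReal.ofReal (exp (∑ i, corrLLR (r i) (ω i))) := by
  have : ∀ i, IsProbabilityMeasure
      (stdGaussPair.withDensity fun p => ENNReal.ofReal (exp (corrLLR (r i) p))) := fun i => by
    rw [← map_corrMap_stdGaussPair (hr i)]
    exact Measure.isProbabilityMeasure_map (by fun_prop)
  have : ∀ i, IsProbabilityMeasure (stdGaussPair.map (corrMap (r i))) := fun i =>
    Measure.isProbabilityMeasure_map (by fun_prop)
  rw [Measure.pi_map_pi (fun i => (measurable_corrMap (r i)).aemeasurable)]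
  simp_rw [map_corrMap_stdGaussPair (hr _)]
  rw [pi_withDensity _ (fun i => by fun_prop)]
  congr 1
  ext ω
  rw [exp_sum, ENNReal.ofReal_prod_of_nonneg fun i _ => (exp_pos _).le]

/-- The averaged likelihood ratio over a group of relabelings of the second coordinates is
unlikely to be small under the correlated law. -/
lemma measure_sum_exp_corrLLR_lt_le {ι G : Type*} [Fintype ι] [Group G] [Fintype G]
    (σ : G →* Equiv.Perm ι) {r : ι → ℝ} (hr : ∀ i, r i ^ 2 < 1) (t : ℝ) :
    (Measure.pi fun _ : ι => stdGaussPair)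
        {ω | ∑ g, exp (∑ i, corrLLR (r i)
            ((ω i).1, (corrMap (r (σ g i)) (ω (σ g i))).2)) < Fintype.card G * t} ≤
      ENNReal.ofReal t := by
  set P := Measure.pi fun _ : ι => stdGaussPair with hP
  set ell : G → (ι → ℝ × ℝ) → ℝ := fun g ω => exp (∑ i, corrLLR (r i) ((ω i).1, (ω (σ g i)).2))
    with hell
  have hmeas : ∀ g, Measurable (ell g) := fun g => by
    simp only [hell]; fun_prop
  set S : Set (ι → ℝ × ℝ) := {ω | ∑ g, ell g ω < Fintype.card G * t} with hS
  have hSm : MeasurableSet S :=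
    measurableSet_lt (Finset.measurable_sum _ fun g _ => hmeas g) measurable_const
  have hT : Measurable fun (ω : ι → ℝ × ℝ) i => corrMap (r i) (ω i) := by fun_prop
  have hpre : P {ω | ∑ g, exp (∑ i, corrLLR (r i)
            ((ω i).1, (corrMap (r (σ g i)) (ω (σ g i))).2)) < Fintype.card G * t} =
      ∫⁻ ω in S, ENNReal.ofReal (ell 1 ω) ∂P := by
    have h1 := congrArg (fun m => m S) (map_corrMap_pi (ι := ι) hr)
    simp only [Measure.map_apply hT hSm, withDensity_apply _ hSm] at h1
    have h2 : ∀ ω, ell 1 ω = exp (∑ i, corrLLR (r i) (ω i)) := fun ω => by simp [hell]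
    simp_rw [h2]
    exact h1
  have hsymm : ∀ g, ∫⁻ ω in S, ENNReal.ofReal (ell g ω) ∂P =
      ∫⁻ ω in S, ENNReal.ofReal (ell 1 ω) ∂P := fun g => by
    have hmp := measurePreserving_reindex_snd (σ g)
    have hcomp : ∀ h ω, ell h (fun i => ((ω i).1, (ω (σ g i)).2)) = ell (g * h) ω := fun h ω => by
      simp [hell]
    have hpreS : (fun (ω : ι → ℝ × ℝ) i => ((ω i).1, (ω (σ g i)).2)) ⁻¹' S = S := by
      ext ω
      simp only [hS, Set.mem_preimage, Set.mem_ofPred_eq, hcomp]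
      rw [← Equiv.sum_comp (Equiv.mulLeft g) (fun h => ell h ω)]
      rfl
    have := hmp.setLIntegral_comp_preimage hSm (f := fun ω => ENNReal.ofReal (ell 1 ω))
      (by have := hmeas 1; fun_prop)
    rw [hpreS] at this
    simpa only [hcomp, mul_one] using this
  have hcard : (Fintype.card G : ℝ≥0∞) ≠ 0 := by simp
  rw [hpre, ← ENNReal.mul_le_mul_iff_right hcard (ENNReal.natCast_ne_top _)]
  calc (Fintype.card G : ℝ≥0∞) * ∫⁻ ω in S, ENNReal.ofReal (ell 1 ω) ∂P
      = ∑ g, ∫⁻ ω in S, ENNReal.ofReal (ell g ω) ∂P := by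
        simp [hsymm]
    _ = ∫⁻ ω in S, ENNReal.ofReal (∑ g, ell g ω) ∂P := by
        rw [← lintegral_finsetSum _ fun g _ => (hmeas g).ennreal_ofReal]
        refine lintegral_congr fun ω => ?_
        rw [ENNReal.ofReal_sum_of_nonneg fun g _ => (exp_pos _).le]
    _ ≤ ∫⁻ _ in S, ENNReal.ofReal (Fintype.card G * t) ∂P :=
        setLIntegral_mono' hSm fun ω hω => ENNReal.ofReal_le_ofReal (le_of_lt hω)
    _ ≤ ENNReal.ofReal (Fintype.card G * t) := by
        rw [setLIntegral_const]
        exact mul_le_of_le_one_right' prob_le_one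
    _ = Fintype.card G * ENNReal.ofReal t := by
        rw [ENNReal.ofReal_mul (by positivity), ENNReal.ofReal_natCast]

/-- The fluctuation of the log-likelihood ratio under the correlated law. -/
def corrFluct (r : ℝ) (p : ℝ × ℝ) : ℝ := ((r * p.1 + √(1 - r ^ 2) * p.2) ^ 2 - p.2 ^ 2) / 2

lemma integrable_of_memLp_mul {f g : ℝ × ℝ → ℝ} (hf : MemLp f 2 stdGaussPair)
    (hg : MemLp g 2 stdGaussPair) : Integrable (fun p => f p * g p) stdGaussPair :=
  hf.integrable_mul hg

lemma memLp_fst (q : ℝ≥0∞) (hq : q ≠ ∞) : MemLp (fun p : ℝ × ℝ => p.1) q stdGaussPair :=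
  (memLp_id_gaussianReal' q hq).comp_measurePreserving measurePreserving_fst

lemma memLp_snd (q : ℝ≥0∞) (hq : q ≠ ∞) : MemLp (fun p : ℝ × ℝ => p.2) q stdGaussPair :=
  (memLp_id_gaussianReal' q hq).comp_measurePreserving measurePreserving_snd

lemma memLp_two_mul {f g : ℝ × ℝ → ℝ} (hf : MemLp f 4 stdGaussPair)
    (hg : MemLp g 4 stdGaussPair) : MemLp (fun p => f p * g p) 2 stdGaussPair := by
  have : ENNReal.HolderTriple 4 4 2 := ⟨by
    rw [show (4 : ℝ≥0∞) = 2 * 2 by norm_num, ENNReal.mul_inv (by simp) (by simp), ← mul_add,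
      ENNReal.inv_two_add_inv_two, mul_one]⟩
  exact hg.mul' hf

lemma corrFluct_eq {r : ℝ} (hr : r ^ 2 < 1) (p : ℝ × ℝ) :
    corrFluct r p = r * (r / 2 * (p.1 * p.1 - p.2 * p.2) + √(1 - r ^ 2) * (p.1 * p.2)) := by
  have h : √(1 - r ^ 2) ^ 2 = 1 - r ^ 2 := sq_sqrt (by linarith)
  unfold corrFluct
  linear_combination p.2 ^ 2 / 2 * h

lemma memLp_corrFluct {r : ℝ} (hr : r ^ 2 < 1) : MemLp (corrFluct r) 2 stdGaussPair := by
  have h1 := memLp_fst 4 (by simp)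
  have h2 := memLp_snd 4 (by simp)
  have h := ((((memLp_two_mul h1 h1).sub (memLp_two_mul h2 h2)).const_mul (r / 2)).add
    ((memLp_two_mul h1 h2).const_mul √(1 - r ^ 2))).const_mul r
  convert h using 1
  ext p
  exact corrFluct_eq hr p

lemma integral_corrFluct {r : ℝ} (hr : r ^ 2 < 1) : ∫ p, corrFluct r p ∂stdGaussPair = 0 := by
  have h1 := memLp_fst 2 (by simp)
  have h2 := memLp_snd 2 (by simp)
  have e1 : ∫ p, p.1 * p.1 ∂stdGaussPair = ∫ p, p.2 * p.2 ∂stdGaussPair := by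
    rw [stdGaussPair, integral_fun_fst (fun x : ℝ => x * x), integral_fun_snd (fun x : ℝ => x * x)]
  have e2 : ∫ p, p.1 * p.2 ∂stdGaussPair = 0 := by
    rw [stdGaussPair, integral_prod_mul (fun x : ℝ => x) fun x : ℝ => x]
    simp
  have i11 := integrable_of_memLp_mul h1 h1
  have i22 := integrable_of_memLp_mul h2 h2
  have i12 := integrable_of_memLp_mul h1 h2
  have i0 : Integrable (fun p : ℝ × ℝ => p.1 * p.1 - p.2 * p.2) stdGaussPair := i11.sub i22
  simp_rw [corrFluct_eq hr]
  rw [integral_const_mul, integral_add (i0.const_mul _) (i12.const_mul _),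
    integral_const_mul, integral_const_mul, integral_sub i11 i22, e1, e2]
  ring

/-- A bound on the variance of `corrFluct r`, per unit of `r ^ 2`. -/
def fluctConst : ℝ :=
  ∫ p, 2 * ((p.1 * p.1 - p.2 * p.2) ^ 2 + (p.1 * p.2) ^ 2) ∂stdGaussPair

lemma fluctConst_nonneg : 0 ≤ fluctConst := integral_nonneg fun p => by positivity

lemma variance_corrFluct_le {r : ℝ} (hr : r ^ 2 < 1) :
    Var[corrFluct r; stdGaussPair] ≤ fluctConst * r ^ 2 := by
  have h1 := memLp_fst 4 (by simp)
  have h2 := memLp_snd 4 (by simp)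
  refine (variance_le_expectation_sq (memLp_corrFluct hr).aestronglyMeasurable).trans ?_
  rw [fluctConst, ← integral_mul_const]
  refine integral_mono (memLp_corrFluct hr).integrable_sq ?_ fun p => ?_
  · exact ((((memLp_two_mul h1 h1).sub (memLp_two_mul h2 h2)).integrable_sq.add
      (memLp_two_mul h1 h2).integrable_sq).const_mul 2).mul_const _
  · have hs : √(1 - r ^ 2) ^ 2 = 1 - r ^ 2 := sq_sqrt (by linarith)
    simp only [Pi.pow_apply, corrFluct_eq hr]
    set u := p.1 * p.1 - p.2 * p.2
    set v := p.1 * p.2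
    set s := √(1 - r ^ 2)
    have h3 : (r / 2 * u + s * v) ^ 2 ≤ 2 * (u ^ 2 + v ^ 2) := by
      have hs1 : s ^ 2 ≤ 1 := by nlinarith [sq_nonneg r]
      nlinarith [sq_nonneg (r / 2 * u - s * v), mul_nonneg (sub_nonneg.2 hr.le) (sq_nonneg u),
        mul_nonneg (sub_nonneg.2 hs1) (sq_nonneg v), sq_nonneg u, sq_nonneg v]
    rw [mul_pow, mul_comm]
    exact mul_le_mul_of_nonneg_right h3 (sq_nonneg r)

/-- Upper tail of the log-likelihood ratio under the correlated law. -/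
lemma measure_le_sum_corrLLR_le {ι : Type*} [Fintype ι] {r : ι → ℝ} (hr : ∀ i, r i ^ 2 < 1)
    {x : ℝ} (hx : 0 < x) :
    (Measure.pi fun _ : ι => stdGaussPair)
        {ω | (∑ i, r i ^ 2 / (1 - r i ^ 2)) / 2 + x ≤
          ∑ i, corrLLR (r i) (corrMap (r i) (ω i))} ≤
      ENNReal.ofReal (fluctConst * (∑ i, r i ^ 2 / (1 - r i ^ 2)) / x ^ 2) := by
  set P := Measure.pi fun _ : ι => stdGaussPair with hP
  set F : (ι → ℝ × ℝ) → ℝ := ∑ i, fun ω => corrFluct (r i) (ω i) with hF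
  have hLp : ∀ i, MemLp (fun ω : ι → ℝ × ℝ => corrFluct (r i) (ω i)) 2 P := fun i =>
    (memLp_corrFluct (hr i)).comp_measurePreserving (measurePreserving_eval _ i)
  have hFLp : MemLp F 2 P := memLp_finsetSum' _ fun i _ => hLp i
  have hmean : ∫ ω, F ω ∂P = 0 := by
    simp only [hF, Finset.sum_apply]
    rw [integral_finsetSum _ fun i _ => (hLp i).integrable (by norm_num)]
    refine Finset.sum_eq_zero fun i _ => ?_
    rw [hP, integral_comp_eval (μ := fun _ => stdGaussPair)
      (memLp_corrFluct (hr i)).aestronglyMeasurable, integral_corrFluct (hr i)]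
  have hle : ∀ i, r i ^ 2 ≤ r i ^ 2 / (1 - r i ^ 2) := fun i => by
    rw [le_div_iff₀ (by linarith [hr i])]
    nlinarith [sq_nonneg (r i)]
  have hvar : Var[F; P] ≤ fluctConst * ∑ i, r i ^ 2 / (1 - r i ^ 2) := by
    rw [hF, hP, variance_sum_pi fun i => memLp_corrFluct (hr i), Finset.mul_sum]
    exact Finset.sum_le_sum fun i _ => (variance_corrFluct_le (hr i)).trans
      (mul_le_mul_of_nonneg_left (hle i) fluctConst_nonneg)
  have hlog : ∀ i, - log (1 - r i ^ 2) / 2 ≤ r i ^ 2 / (1 - r i ^ 2) / 2 := fun i => by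
    have h0 : 0 < 1 - r i ^ 2 := by linarith [hr i]
    have := log_le_sub_one_of_pos (inv_pos.2 h0)
    rw [log_inv] at this
    have h2 : (1 - r i ^ 2)⁻¹ - 1 = r i ^ 2 / (1 - r i ^ 2) := by field_simp; ring
    linarith
  refine (measure_mono fun ω hω => ?_).trans ((meas_ge_le_variance_div_sq hFLp hx).trans
    (ENNReal.ofReal_le_ofReal (div_le_div_of_nonneg_right hvar (by positivity))))
  simp only [Set.mem_ofPred_eq] at hω ⊢
  rw [hmean, sub_zero]
  refine le_trans ?_ (le_abs_self _)
  have h1 : ∑ i, corrLLR (r i) (corrMap (r i) (ω i)) =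
      F ω + ∑ i, - log (1 - r i ^ 2) / 2 := by
    simp only [hF, Finset.sum_apply, ← Finset.sum_add_distrib]
    refine Finset.sum_congr rfl fun i _ => ?_
    rw [corrLLR_corrMap (hr i), corrFluct]
    ring
  have h2 := Finset.sum_le_sum fun i (_ : i ∈ Finset.univ) => hlog i
  rw [← Finset.sum_div _ fun i => r i ^ 2 / (1 - r i ^ 2)] at h2
  linarith

/-- Lower tail of the likelihood-weighted sum over a group of relabelings. -/
lemma measure_sum_exp_corrLLR_sub_lt_le {ι G : Type*} [Fintype ι] [Group G] [Fintype G]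
    (σ : G →* Equiv.Perm ι) {r : ι → ℝ} (hr : ∀ i, r i ^ 2 < 1) {x : ℝ} (hx : 0 < x) :
    (Measure.pi fun _ : ι => stdGaussPair)
        {ω | ∑ g, exp (∑ i, corrLLR (r i) ((ω i).1, (corrMap (r (σ g i)) (ω (σ g i))).2) -
            ∑ i, corrLLR (r i) (corrMap (r i) (ω i))) <
          Fintype.card G * exp (-((∑ i, r i ^ 2 / (1 - r i ^ 2)) / 2 + 2 * x))} ≤
      ENNReal.ofReal (exp (-x)) +
        ENNReal.ofReal (fluctConst * (∑ i, r i ^ 2 / (1 - r i ^ 2)) / x ^ 2) := by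
  refine le_trans ?_ (add_le_add (measure_sum_exp_corrLLR_lt_le σ hr (exp (-x)))
    (measure_le_sum_corrLLR_le hr hx))
  refine (measure_mono fun ω hω => ?_).trans (measure_union_le _ _)
  by_contra hcon
  simp only [Set.mem_union, Set.mem_ofPred_eq, not_or, not_lt, not_le] at hω hcon
  obtain ⟨h1, h2⟩ := hcon
  simp_rw [exp_sub, ← Finset.sum_div] at hω
  rw [div_lt_iff₀ (exp_pos _), mul_assoc, ← exp_add] at hω
  refine (h1.trans_lt hω).not_ge (mul_le_mul_of_nonneg_left (exp_le_exp.2 ?_) (by positivity))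
  linarith

/-- The action of a vertex relabeling on ordered pairs `i < j`, fixing the other pairs. -/
def edgeMap {n : ℕ} (φ : Equiv.Perm (Fin n)) (p : Fin n × Fin n) : Fin n × Fin n :=
  if p.1 < p.2 then (min (φ p.1) (φ p.2), max (φ p.1) (φ p.2)) else p

lemma edgeMap_lt_iff {n : ℕ} (φ : Equiv.Perm (Fin n)) (p : Fin n × Fin n) :
    (edgeMap φ p).1 < (edgeMap φ p).2 ↔ p.1 < p.2 := by
  unfold edgeMap
  split_ifs with h
  · simpa [h] using h.ne'
  · rfl

lemma edgeMap_mul {n : ℕ} (φ ψ : Equiv.Perm (Fin n)) (p : Fin n × Fin n) :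
    edgeMap (φ * ψ) p = edgeMap φ (edgeMap ψ p) := by
  by_cases h : p.1 < p.2
  · have h1 := (edgeMap_lt_iff ψ p).2 h
    rw [edgeMap, if_pos h, edgeMap, if_pos h1, edgeMap, if_pos h]
    rcases le_total (ψ p.1) (ψ p.2) with h2 | h2 <;> simp [h2, min_comm, max_comm]
  · have h1 := (edgeMap_lt_iff ψ p).not.2 h
    rw [edgeMap, if_neg h, edgeMap, if_neg h1, edgeMap, if_neg h]

/-- The index set of all pairs of correlated variables. -/
abbrev CoordIdx (n d : ℕ) := (Fin n × Fin n) ⊕ (Fin n × Fin d)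

/-- The action of vertex relabelings on the index set of the model. -/
def coordPerm (n d : ℕ) : Equiv.Perm (Fin n) →* Equiv.Perm (CoordIdx n d) :=
  MonoidHom.toHomPerm
    { toFun := fun φ => Sum.map (edgeMap φ) (Prod.map φ id)
      map_one' := by
        funext i
        change Sum.map (edgeMap 1) (Prod.map (1 : Equiv.Perm (Fin n)) id) i = i
        rcases i with p | p
        · by_cases h : p.1 < p.2
          · simp [edgeMap, h, h.le]
          · simp [edgeMap, h]
        · simp
      map_mul' := fun φ ψ => by
        funext i
        change _ = Sum.map (edgeMap φ) (Prod.map φ id) (Sum.map (edgeMap ψ) (Prod.map ψ id) i)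
        rcases i with p | p
        · simp [edgeMap_mul]
        · rfl }

@[simp]
lemma coordPerm_inl {n d : ℕ} (φ : Equiv.Perm (Fin n)) (p : Fin n × Fin n) :
    coordPerm n d φ (Sum.inl p) = Sum.inl (edgeMap φ p) := rfl

@[simp]
lemma coordPerm_inr {n d : ℕ} (φ : Equiv.Perm (Fin n)) (p : Fin n × Fin d) :
    coordPerm n d φ (Sum.inr p) = Sum.inr (φ p.1, p.2) := rfl

/-- The correlation carried by each index; unused graph coordinates are uncorrelated. -/
def coordCorr {n d : ℕ} (ρ η : ℝ) : CoordIdx n d → ℝ :=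
  Sum.elim (fun p => if p.1 < p.2 then ρ else 0) fun _ => η

lemma coordCorr_coordPerm {n d : ℕ} (ρ η : ℝ) (φ : Equiv.Perm (Fin n)) (i : CoordIdx n d) :
    coordCorr ρ η (coordPerm n d φ i) = coordCorr ρ η i := by
  rcases i with p | p
  · simp [coordCorr, edgeMap_lt_iff]
  · simp [coordCorr]

lemma coordCorr_sq_lt {n d : ℕ} {ρ η : ℝ} (hρ : ρ ^ 2 < 1) (hη : η ^ 2 < 1)
    (i : CoordIdx n d) : coordCorr ρ η i ^ 2 < 1 := by
  rcases i with p | p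
  · simp only [coordCorr, Sum.elim_inl]
    split_ifs <;> simp [hρ]
  · simpa [coordCorr] using hη

/-- Rearrangement of a family of pairs into a point of the sample space. -/
def toSamp {n d : ℕ} (ω : CoordIdx n d → ℝ × ℝ) : Samp n d :=
  ((fun i j => (ω (Sum.inl (i, j))).1, fun i j => (ω (Sum.inl (i, j))).2),
    (fun i j => (ω (Sum.inr (i, j))).1, fun i j => (ω (Sum.inr (i, j))).2))

lemma measurePreserving_curry_pi {κ l : Type*} [Fintype κ] [Fintype l] (m : Measure ℝ)
    [IsProbabilityMeasure m] :
    MeasurePreserving (MeasurableEquiv.curry κ l ℝ) (Measure.pi fun _ => m)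
      (Measure.pi fun _ => Measure.pi fun _ => m) := by
  refine ⟨MeasurableEquiv.measurable _, ?_⟩
  have := Measure.infinitePi_map_curry (ι := κ) (κ := l) (fun _ _ => m)
  simpa only [Measure.infinitePi_eq_pi] using this

lemma measurePreserving_toSamp (n d : ℕ) :
    MeasurePreserving (toSamp (n := n) (d := d)) (Measure.pi fun _ => stdGaussPair) (μ n d) := by
  have h1 := measurePreserving_sumPiEquivProdPi (fun _ : CoordIdx n d => stdGaussPair)
  have h2 : ∀ k l : ℕ, MeasurePreserving _
      (Measure.pi fun _ : Fin k × Fin l => stdGaussPair) _ := fun k l =>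
    ((measurePreserving_curry_pi (κ := Fin k) (l := Fin l) (gaussianReal 0 1)).prod
      (measurePreserving_curry_pi (gaussianReal 0 1))).comp
    (measurePreserving_arrowProdEquivProdArrow ℝ ℝ (Fin k × Fin l)
      (fun _ => gaussianReal 0 1) (fun _ => gaussianReal 0 1))
  exact ((h2 n n).prod (h2 n d)).comp h1

section Hamiltonian

variable {n d : ℕ} (ρ η : ℝ) (φ : Equiv.Perm (Fin n)) (ω : CoordIdx n d → ℝ × ℝ)

lemma sum_corrLLR_sub :
    ∑ i, corrLLR (coordCorr ρ η i) ((ω i).1, (corrMap (coordCorr ρ η (coordPerm n d φ i))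
        (ω (coordPerm n d φ i))).2) -
      ∑ i, corrLLR (coordCorr ρ η i) (corrMap (coordCorr ρ η i) (ω i)) =
    -∑ i, coordCorr ρ η i / (1 - coordCorr ρ η i ^ 2) *
      (((corrMap (coordCorr ρ η i) (ω i)).2 - (corrMap (coordCorr ρ η (coordPerm n d φ i))
        (ω (coordPerm n d φ i))).2) * (ω i).1) := by
  have hsum := Equiv.sum_comp (coordPerm n d φ) fun i =>
    coordCorr ρ η i ^ 2 / (2 * (1 - coordCorr ρ η i ^ 2)) *
      (corrMap (coordCorr ρ η i) (ω i)).2 ^ 2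
  simp only [coordCorr_coordPerm] at hsum ⊢
  rw [← sub_eq_zero, ← Finset.sum_sub_distrib] at hsum
  rw [← Finset.sum_sub_distrib, ← Finset.sum_neg_distrib, ← sub_eq_zero,
    ← Finset.sum_sub_distrib, ← neg_eq_zero, ← hsum, ← Finset.sum_neg_distrib]
  refine Finset.sum_congr rfl fun i _ => ?_
  simp only [corrLLR, corrMap]
  ring

lemma Bmat_toSamp {i j : Fin n} (h : i < j) :
    Bmat ρ (toSamp ω) i j = (corrMap ρ (ω (Sum.inl (i, j)))).2 := by
  simp [Bmat, Amat, sym, h.le, toSamp, corrMap]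

lemma Bmat_comm (s : Samp n d) (i j : Fin n) : Bmat ρ s i j = Bmat ρ s j i := by
  simp only [Bmat, Amat, sym]
  rcases lt_trichotomy i j with h | h | h
  · simp [h.le, h.not_ge]
  · simp [h]
  · simp [h.le, h.not_ge]

lemma Bmat_edgeMap {p : Fin n × Fin n} (h : p.1 < p.2) :
    Bmat ρ (toSamp ω) (φ p.1) (φ p.2) = (corrMap ρ (ω (Sum.inl (edgeMap φ p)))).2 := by
  have h1 := (edgeMap_lt_iff φ p).2 h
  rw [← Bmat_toSamp ρ ω h1, edgeMap, if_pos h]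
  rcases le_total (φ p.1) (φ p.2) with h2 | h2
  · simp [h2]
  · simp [h2, Bmat_comm ρ _ (φ p.1)]

lemma V_toSamp :
    V ρ η φ (toSamp ω) = ∑ i, coordCorr ρ η i / (1 - coordCorr ρ η i ^ 2) *
      (((corrMap (coordCorr ρ η i) (ω i)).2 - (corrMap (coordCorr ρ η (coordPerm n d φ i))
        (ω (coordPerm n d φ i))).2) * (ω i).1) := by
  simp only [coordCorr_coordPerm]
  rw [Fintype.sum_sum_type, V]
  congr 1
  · rw [VGstar, VG, ← Finset.sum_sub_distrib, Finset.mul_sum]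
    refine Finset.sum_subset_zero_on_sdiff (Finset.subset_univ _) (fun p hp => ?_) fun p hp => ?_
    · by_cases h : p.1 < p.2
      · have hp' : (φ p.1 = p.1 ∧ φ p.2 = p.2) ∨ (φ p.1 = p.2 ∧ φ p.2 = p.1) := by
          by_contra hcon
          exact (Finset.mem_sdiff.1 hp).2 (Finset.mem_filter.2 ⟨Finset.mem_univ _, h, hcon⟩)
        have : edgeMap φ p = p := by
          rcases hp' with ⟨h1, h2⟩ | ⟨h1, h2⟩ <;> simp [edgeMap, h, h1, h2, h.le]
        simp [this]
      · simp [coordCorr, h]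
    · have h : p.1 < p.2 := (Finset.mem_filter.1 hp).2.1
      rw [Bmat_edgeMap ρ φ ω h, Bmat_toSamp ρ ω h]
      simp only [coordCorr, coordPerm_inl, Sum.elim_inl, if_pos h, Amat, sym, if_pos h.le, toSamp]
      ring
  · rw [VFstar, VF, ← Finset.sum_sub_distrib, Finset.mul_sum, Fintype.sum_prod_type]
    refine Finset.sum_subset_zero_on_sdiff (Finset.subset_univ _) (fun i hi => ?_) fun i hi => ?_
    · have hi' : φ i = i := by simpa using hi
      simp [hi']
    · rw [← Finset.sum_sub_distrib, Finset.mul_sum]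
      refine Finset.sum_congr rfl fun j _ => ?_
      simp only [coordCorr, coordPerm_inr, Sum.elim_inr, Ymat, Xmat, toSamp, corrMap]
      ring

end Hamiltonian

lemma sum_coordCorr_le (n d : ℕ) {ρ η : ℝ} (hρ : ρ ^ 2 < 1) :
    ∑ i : CoordIdx n d, coordCorr ρ η i ^ 2 / (1 - coordCorr ρ η i ^ 2) ≤
      n / 2 * (ρ ^ 2 * n / (1 - ρ ^ 2) + 2 * η ^ 2 * d / (1 - η ^ 2)) := by
  set f : Fin n × Fin n → ℝ := fun p => if p.1 < p.2 then ρ ^ 2 / (1 - ρ ^ 2) else 0 with hf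
  have hc : 0 ≤ ρ ^ 2 / (1 - ρ ^ 2) := div_nonneg (sq_nonneg _) (by linarith)
  have h1 : ∑ p, f p + ∑ p, f p ≤ n * n * (ρ ^ 2 / (1 - ρ ^ 2)) := by
    nth_rewrite 2 [← Equiv.sum_comp (Equiv.prodComm (Fin n) (Fin n)) f]
    rw [← Finset.sum_add_distrib]
    calc _ ≤ ∑ _p : Fin n × Fin n, ρ ^ 2 / (1 - ρ ^ 2) := by
          refine Finset.sum_le_sum fun p _ => ?_
          rcases lt_trichotomy p.1 p.2 with h | h | h
          · simp [hf, h, h.not_gt]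
          · simpa [hf, h] using hc
          · simp [hf, h, h.not_gt]
      _ = _ := by simp
  have h2 : ∀ p : Fin n × Fin n, coordCorr (d := d) ρ η (Sum.inl p) ^ 2 /
      (1 - coordCorr (d := d) ρ η (Sum.inl p) ^ 2) = f p := fun p => by
    simp only [coordCorr, Sum.elim_inl, hf]
    split_ifs <;> simp
  rw [Fintype.sum_sum_type, Finset.sum_congr rfl fun p _ => h2 p]
  simp only [coordCorr, Sum.elim_inr, Finset.sum_const, Finset.card_univ, Fintype.card_prod,
    Fintype.card_fin, nsmul_eq_mul, Nat.cast_mul]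
  linarith [show (n : ℝ) / 2 * (ρ ^ 2 * n / (1 - ρ ^ 2) + 2 * η ^ 2 * d / (1 - η ^ 2)) =
    n * n * (ρ ^ 2 / (1 - ρ ^ 2)) / 2 + n * d * (η ^ 2 / (1 - η ^ 2)) by ring]

/-- A nonasymptotic lower bound on the partition function, away from perfect correlations. -/
lemma measure_Zpart_lower_bound_of_sq_lt_one {n d : ℕ} (hn : n ≠ 0) {ρ η ε : ℝ} (hρ : ρ ^ 2 < 1)
    (hη : η ^ 2 < 1)
    (hsig : ρ ^ 2 * n / (1 - ρ ^ 2) + 2 * η ^ 2 * d / (1 - η ^ 2) ≤ 2 * (1 - ε) * log n) :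
    1 - (ENNReal.ofReal (exp (-n)) + ENNReal.ofReal (fluctConst * (1 - ε) * (log n / n))) ≤
      μ n d {ω | exp ((1 + ε) / 2 * n * log n - 3 * n) ≤ Zpart ρ η ω} := by
  have hn0 : (0 : ℝ) < n := by positivity
  set K := ∑ i : CoordIdx n d, coordCorr ρ η i ^ 2 / (1 - coordCorr ρ η i ^ 2) with hK
  have hKle : K ≤ (1 - ε) * n * log n := by
    refine (sum_coordCorr_le n d hρ).trans ?_
    calc _ ≤ (n : ℝ) / 2 * (2 * (1 - ε) * log n) := by gcongr
      _ = _ := by ring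
  set A := toSamp ⁻¹' {ω : Samp n d | exp ((1 + ε) / 2 * n * log n - 3 * n) ≤ Zpart ρ η ω}
    with hA
  set P := Measure.pi fun _ : CoordIdx n d => stdGaussPair
  have hAP : P A ≤ μ n d {ω | exp ((1 + ε) / 2 * n * log n - 3 * n) ≤ Zpart ρ η ω} := by
    rw [← (measurePreserving_toSamp n d).map_eq]
    exact Measure.le_map_apply (measurePreserving_toSamp n d).aemeasurable _
  have hbad : P Aᶜ ≤ ENNReal.ofReal (exp (-n)) +
      ENNReal.ofReal (fluctConst * (1 - ε) * (log n / n)) := by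
    refine (measure_mono fun ω hω => ?_).trans
      ((measure_sum_exp_corrLLR_sub_lt_le (coordPerm n d) (coordCorr_sq_lt hρ hη) hn0).trans
        (add_le_add le_rfl (ENNReal.ofReal_le_ofReal ?_)))
    · simp only [hA, Set.mem_compl_iff, Set.mem_preimage, Set.mem_ofPred_eq, not_le] at hω ⊢
      simp_rw [sum_corrLLR_sub, ← V_toSamp]
      refine hω.trans_le ?_
      have hcard : (0 : ℝ) < (Fintype.card (Equiv.Perm (Fin n)) : ℝ) := by
        exact_mod_cast Fintype.card_pos
      rw [← exp_log hcard, ← exp_add, exp_le_exp, Fintype.card_perm, Fintype.card_fin]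
      have hst := Stirling.le_log_factorial_stirling hn
      have h1 : 0 ≤ log (n : ℝ) := log_natCast_nonneg n
      have h2 : 0 ≤ log (2 * π) := log_nonneg (by linarith [pi_gt_three])
      linarith
    · calc fluctConst * K / (n : ℝ) ^ 2 ≤ fluctConst * ((1 - ε) * n * log n) / (n : ℝ) ^ 2 := by
            have := fluctConst_nonneg
            gcongr
        _ = _ := by field_simp
  refine le_trans ?_ hAP
  rw [tsub_le_iff_right]
  calc (1 : ℝ≥0∞) = P Set.univ := measure_univ.symm
    _ = P (A ∪ Aᶜ) := by rw [Set.union_compl_self]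
    _ ≤ P A + P Aᶜ := measure_union_le _ _
    _ ≤ _ := by gcongr

/-- A nonasymptotic lower bound on the partition function. -/
lemma measure_Zpart_lower_bound {n d : ℕ} (hn : n ≠ 0) {ρ η ε : ℝ}
    (hρ : ρ ∈ Set.Icc (-1 : ℝ) 1) (hη : η ∈ Set.Icc (-1 : ℝ) 1)
    (hsig : ρ ^ 2 * n / (1 - ρ ^ 2) + 2 * η ^ 2 * d / (1 - η ^ 2) ≤ 2 * (1 - ε) * log n) :
    1 - (ENNReal.ofReal (exp (-n)) + ENNReal.ofReal (fluctConst * (1 - ε) * (log n / n))) ≤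
      μ n d {ω | exp ((1 + ε) / 2 * n * log n - 3 * n) ≤ Zpart ρ η ω} := by
  -- At perfect correlation the corresponding coefficient of `V` vanishes, as it does at zero.
  have key : ∀ r ∈ Set.Icc (-1 : ℝ) 1, ∃ r' : ℝ, r' ^ 2 < 1 ∧ (r ^ 2 < 1 → r' = r) ∧
      (¬ r ^ 2 < 1 → r' = 0 ∧ 1 - r ^ 2 = 0) := fun r hr => by
    by_cases h : r ^ 2 < 1
    · exact ⟨r, h, fun _ => rfl, fun h' => absurd h h'⟩
    · refine ⟨0, by norm_num, fun h' => absurd h' h, fun _ => ⟨rfl, ?_⟩⟩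
      nlinarith [hr.1, hr.2]
  obtain ⟨ρ', hρ', hρ1, hρ2⟩ := key ρ hρ
  obtain ⟨η', hη', hη1, hη2⟩ := key η hη
  have hZ : ∀ ω : Samp n d, Zpart ρ η ω = Zpart ρ' η' ω := fun ω => by
    refine Finset.sum_congr rfl fun φ _ => ?_
    simp only [V]
    congr 3
    · by_cases h : ρ ^ 2 < 1
      · rw [hρ1 h]
      · simp [hρ2 h]
    · by_cases h : η ^ 2 < 1
      · rw [hη1 h]
      · simp [hη2 h]
  simp_rw [hZ]
  refine measure_Zpart_lower_bound_of_sq_lt_one hn hρ' hη' (le_trans (le_of_eq ?_) hsig)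
  congr 1
  · by_cases h : ρ ^ 2 < 1
    · rw [hρ1 h]
    · simp [hρ2 h]
  · by_cases h : η ^ 2 < 1
    · rw [hη1 h]
    · simp [hη2 h]

end CGM

open CGM in
/-- **Lower bound on the partition function (Lemma 3.4).**  If `d = ω((log n)²)` and
`ρ²n/(1−ρ²) + 2η²d/(1−η²) ≤ 2(1−ε) log n` for some `ε > 0`, then
`Z ≥ exp(((1+ε)/2) n log n (1+o(1)))` with probability `1 − o(1)`. -/
theorem partition_function_lower_bound (d : ℕ → ℕ) (ρ η : ℕ → ℝ)
    (hρ : ∀ n, ρ n ∈ Set.Icc (-1 : ℝ) 1) (hη : ∀ n, η n ∈ Set.Icc (-1 : ℝ) 1)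
    (hd : Tendsto (fun n : ℕ => (d n : ℝ) / (Real.log n) ^ 2) atTop atTop)
    (ε : ℝ) (hε : 0 < ε)
    (hsig : ∀ᶠ n : ℕ in atTop,
      (ρ n) ^ 2 * n / (1 - (ρ n) ^ 2) + 2 * (η n) ^ 2 * (d n) / (1 - (η n) ^ 2) ≤
        2 * (1 - ε) * Real.log n) :
    ∃ c : ℕ → ℝ, Tendsto c atTop (𝓝 0) ∧
      Tendsto (fun n => μ n (d n)
          {ω | Real.exp ((1 + ε) / 2 * n * Real.log n * (1 + c n)) ≤
            Zpart (ρ n) (η n) ω})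
        atTop (𝓝 1) := by
  refine ⟨fun n => -(6 / (1 + ε)) / log n, ?_, ?_⟩
  · exact tendsto_const_nhds.div_atTop (tendsto_log_atTop.comp tendsto_natCast_atTop_atTop)
  have h1 : Tendsto (fun n : ℕ => ENNReal.ofReal (exp (-n))) atTop (𝓝 0) := by
    rw [← ENNReal.ofReal_zero]
    exact ENNReal.tendsto_ofReal
      (tendsto_exp_neg_atTop_nhds_zero.comp tendsto_natCast_atTop_atTop)
  have h2 : Tendsto (fun n : ℕ => ENNReal.ofReal (fluctConst * (1 - ε) * (log n / n)))
      atTop (𝓝 0) := by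
    have h3 : Tendsto (fun n : ℕ => log n / n) atTop (𝓝 0) :=
      (isLittleO_log_id_atTop.tendsto_div_nhds_zero).comp tendsto_natCast_atTop_atTop
    rw [← ENNReal.ofReal_zero]
    refine ENNReal.tendsto_ofReal ?_
    simpa using h3.const_mul (fluctConst * (1 - ε))
  have h4 : Tendsto (fun n : ℕ => 1 - (ENNReal.ofReal (exp (-n)) +
      ENNReal.ofReal (fluctConst * (1 - ε) * (log n / n)))) atTop (𝓝 1) := by
    simpa using ENNReal.Tendsto.sub tendsto_const_nhds (h1.add h2) (Or.inl ENNReal.one_ne_top)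
  have hprob : ∀ n, IsProbabilityMeasure (μ n (d n)) := fun n => by
    rw [← (measurePreserving_toSamp n (d n)).map_eq]
    exact Measure.isProbabilityMeasure_map (measurePreserving_toSamp n (d n)).aemeasurable
  refine tendsto_of_tendsto_of_tendsto_of_le_of_le' h4 tendsto_const_nhds ?_
    (Eventually.of_forall fun n => (hprob n).measure_univ ▸ measure_mono (Set.subset_univ _))
  filter_upwards [hsig, eventually_ge_atTop 2] with n hn hn2
  have hlog : 0 < log (n : ℝ) := log_pos (by exact_mod_cast hn2)
  have hexp : (1 + ε) / 2 * n * log n * (1 + -(6 / (1 + ε)) / log n) =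
      (1 + ε) / 2 * n * log n - 3 * n := by
    field_simp
    ring
  simp_rw [hexp]
  exact measure_Zpart_lower_bound (by omega) (hρ n) (hη n) hn
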